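/- arXiv:1809.05083 — 2 statements merged into one kernel-verified Lean document; each statement's English description precedes it below -/
import Mathlib

section
/- For every integer n ≥ 11, the number of ≡_3-equivalence classes of binary trees of arity n equals n + 3. -/
/-- A binary tree: either a leaf or an ordered pair of binary trees. -/
inductive BTree : Type
  | leaf : BTree
  | node : BTree → BTree → BTree
  deriving DecidableEq

namespace BTree

/-- The arity of a binary tree is its number of leaves. -/
def arity : BTree → ℕ
  | leaf => 1
  | node l r => arity l + arity r

/-- The degree of a binary tree is its number of internal nodes. -/
def degree : BTree → ℕ
  | leaf => 0
  | node l r => degree l + degree r + 1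

/-- Grafting `t ∘ᵢ s`: identify the root of `s` with the `i`-th leaf of `t`
(leaves numbered from left to right, starting at `1`). -/
def graft : BTree → ℕ → BTree → BTree
  | leaf, i, s => if i = 1 then s else leaf
  | node l r, i, s =>
      if i ≤ l.arity then node (l.graft i s) r else node l (r.graft (i - l.arity) s)

/-- Simultaneous grafting `s ∘ [r_1, …, r_n]`: graft the `i`-th element of the
list onto the `i`-th leaf of `s`, simultaneously. -/
def multigraft : BTree → List BTree → BTree
  | leaf, rs => rs.headD leaf
  | node l r, rs => node (l.multigraft (rs.take l.arity)) (r.multigraft (rs.drop l.arity))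

/-- The left comb with `γ` internal nodes. -/
def leftComb : ℕ → BTree
  | 0 => leaf
  | γ + 1 => node (leftComb γ) leaf

/-- The right comb with `γ` internal nodes. -/
def rightComb : ℕ → BTree
  | 0 => leaf
  | γ + 1 => node leaf (rightComb γ)

/-- The prefix word of a binary tree, over the alphabet `{0, 2}`:
a left-to-right depth-first traversal writes `2` for each internal node and
`0` for each leaf. -/
def prefixWord : BTree → List ℕ
  | leaf => [0]
  | node l r => 2 :: (prefixWord l ++ prefixWord r)

/-- The left rank: number of internal nodes on the leftmost branch from the root. -/
def leftRank : BTree → ℕ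
  | leaf => 0
  | node l _ => leftRank l + 1

/-- The mirror of a binary tree. -/
def mirror : BTree → BTree
  | leaf => leaf
  | node l r => node (mirror r) (mirror l)

end BTree

/-- One step of the rewrite relation induced by a set of rewrite rules `R`:
`r ∘ᵢ (s ∘ [r_1, …, r_n]) ⇒ r ∘ᵢ (s' ∘ [r_1, …, r_n])` whenever `R s s'`. -/
def Step (R : BTree → BTree → Prop) (t t' : BTree) : Prop :=
  ∃ (s s' r : BTree) (i : ℕ) (rs : List BTree),
    R s s' ∧ 1 ≤ i ∧ i ≤ r.arity ∧ rs.length = s.arity ∧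
    t = r.graft i (s.multigraft rs) ∧ t' = r.graft i (s'.multigraft rs)

/-- The congruence generated by a set of rewrite rules: the reflexive–symmetric–transitive
closure of the induced rewrite relation. -/
def CongrGen (R : BTree → BTree → Prop) : BTree → BTree → Prop :=
  Relation.EqvGen (Step R)

/-- The tree `s` occurs as a subtree of `t`. -/
def Occurs (s t : BTree) : Prop :=
  ∃ (r : BTree) (i : ℕ) (rs : List BTree),
    1 ≤ i ∧ i ≤ r.arity ∧ rs.length = s.arity ∧ t = r.graft i (s.multigraft rs)

/-- The rewrite relation induced by `R` is terminating: there is no infinite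
chain `t_0 ⇒ t_1 ⇒ t_2 ⇒ ⋯`. -/
def Terminating (R : BTree → BTree → Prop) : Prop :=
  ¬ ∃ f : ℕ → BTree, ∀ n, Step R (f n) (f (n + 1))

/-- The rewrite relation induced by `R` is confluent. -/
def Confluent (R : BTree → BTree → Prop) : Prop :=
  ∀ t s₁ s₂, Relation.ReflTransGen (Step R) t s₁ → Relation.ReflTransGen (Step R) t s₂ →
    ∃ t', Relation.ReflTransGen (Step R) s₁ t' ∧ Relation.ReflTransGen (Step R) s₂ t'

/-- The number of equivalence classes of binary trees of arity `n` under the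
equivalence relation `E`. -/
noncomputable def classCount (E : BTree → BTree → Prop) (n : ℕ) : ℕ :=
  Nat.card (Quot fun a b : {t : BTree // t.arity = n} => E a.1 b.1)

/-- The congruence `≡_γ` generated by the single rewrite rule `(L_γ, R_γ)`. -/
def CAsCongr (γ : ℕ) : BTree → BTree → Prop :=
  CongrGen fun s s' => s = BTree.leftComb γ ∧ s' = BTree.rightComb γ

namespace BTree

/-- The congruence generated by the rule `((a b) c) d ⇒ a (b (c d))`, presented inductively. -/
inductive CombEqv : BTree → BTree → Prop
  | rule (a b c d : BTree) :
      CombEqv (node (node (node a b) c) d) (node a (node b (node c d)))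
  | node {l l' r r' : BTree} : CombEqv l l' → CombEqv r r' → CombEqv (node l r) (node l' r')
  | refl (t : BTree) : CombEqv t t
  | symm {t t' : BTree} : CombEqv t t' → CombEqv t' t
  | trans {t t' t'' : BTree} : CombEqv t t' → CombEqv t' t'' → CombEqv t t''

theorem CombEqv.arity_eq {t t' : BTree} (h : CombEqv t t') : t.arity = t'.arity := by
  induction h with
  | rule => simp only [arity]; omega
  | node _ _ h₁ h₂ => simp only [arity, h₁, h₂]
  | refl => rfl
  | symm _ h => exact h.symm
  | trans _ _ h₁ h₂ => exact h₁.trans h₂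

theorem CombEqv.multigraft {t t' : BTree} (h : CombEqv t t') :
    ∀ rs : List BTree, CombEqv (t.multigraft rs) (t'.multigraft rs) := by
  induction h with
  | rule a b c d =>
    intro rs
    simp only [BTree.multigraft, arity, List.take_take, List.drop_take, List.drop_drop]
    convert CombEqv.rule _ _ _ _ using 4 <;> grind
  | node h _ h₁ h₂ =>
    intro rs
    simp only [BTree.multigraft, h.arity_eq]
    exact .node (h₁ _) (h₂ _)
  | refl => exact fun _ => .refl _
  | symm _ h => exact fun rs => (h rs).symm
  | trans _ _ h₁ h₂ => exact fun rs => (h₁ rs).trans (h₂ rs)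

theorem CombEqv.graft (r : BTree) {t t' : BTree} (h : CombEqv t t') :
    ∀ i : ℕ, CombEqv (r.graft i t) (r.graft i t') := by
  induction r with
  | leaf => intro i; simp only [BTree.graft]; split <;> [exact h; exact .refl _]
  | node l r hl hr =>
    intro i
    simp only [BTree.graft]
    split
    · exact .node (hl _) (.refl _)
    · exact .node (.refl _) (hr _)

theorem arity_pos (t : BTree) : 1 ≤ t.arity := by
  induction t with
  | leaf => exact le_rfl
  | node l r hl hr => simp only [arity]; omega

theorem eq_leaf_of_arity_le_one {t : BTree} (h : t.arity ≤ 1) : t = leaf := by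
  cases t with
  | leaf => rfl
  | node l r =>
    have hl := l.arity_pos
    have hr := r.arity_pos
    simp only [arity] at h
    omega

theorem _root_.Step.node_left {R : BTree → BTree → Prop} {t t' : BTree} (h : Step R t t')
    (u : BTree) : Step R (node t u) (node t' u) := by
  obtain ⟨s, s', r, i, rs, hR, h1, h2, hl, rfl, rfl⟩ := h
  refine ⟨s, s', node r u, i, rs, hR, h1, ?_, hl, ?_, ?_⟩
  · simp only [arity]; omega
  · simp [BTree.graft, h2]
  · simp [BTree.graft, h2]

theorem _root_.Step.node_right {R : BTree → BTree → Prop} {t t' : BTree} (h : Step R t t')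
    (u : BTree) : Step R (node u t) (node u t') := by
  obtain ⟨s, s', r, i, rs, hR, h1, h2, hl, rfl, rfl⟩ := h
  refine ⟨s, s', node u r, i + u.arity, rs, hR, by omega, ?_, hl, ?_, ?_⟩
  · simp only [arity]; omega
  · simp [BTree.graft, show ¬ i = 0 by omega]
  · simp [BTree.graft, show ¬ i = 0 by omega]

theorem _root_.CongrGen.node {R : BTree → BTree → Prop} {l l' r r' : BTree}
    (hl : CongrGen R l l') (hr : CongrGen R r r') : CongrGen R (node l r) (node l' r') := by
  have left (u : BTree) {t t' : BTree} (h : CongrGen R t t') :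
      CongrGen R (.node t u) (.node t' u) := by
    induction h with
    | rel _ _ h => exact .rel _ _ (h.node_left u)
    | refl => exact .refl _
    | symm _ _ _ h => exact .symm _ _ h
    | trans _ _ _ _ _ h₁ h₂ => exact .trans _ _ _ h₁ h₂
  have right (u : BTree) {t t' : BTree} (h : CongrGen R t t') :
      CongrGen R (.node u t) (.node u t') := by
    induction h with
    | rel _ _ h => exact .rel _ _ (h.node_right u)
    | refl => exact .refl _
    | symm _ _ _ h => exact .symm _ _ h
    | trans _ _ _ _ _ h₁ h₂ => exact .trans _ _ _ h₁ h₂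
  exact .trans _ _ _ (left r hl) (right l' hr)

theorem cAsCongr_three_iff {t t' : BTree} : CAsCongr 3 t t' ↔ CombEqv t t' := by
  constructor
  · intro h
    induction h with
    | rel _ _ h =>
      obtain ⟨_, _, r, i, rs, ⟨rfl, rfl⟩, -, -, -, rfl, rfl⟩ := h
      exact ((CombEqv.rule leaf leaf leaf leaf).multigraft rs).graft r i
    | refl => exact .refl _
    | symm _ _ _ h => exact h.symm
    | trans _ _ _ _ _ h₁ h₂ => exact h₁.trans h₂
  · intro h
    induction h with
    | rule a b c d =>
      exact .rel _ _ ⟨_, _, leaf, 1, [a, b, c, d], ⟨rfl, rfl⟩, le_rfl, le_rfl, rfl, rfl, rfl⟩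
    | node _ _ h₁ h₂ => exact h₁.node h₂
    | refl => exact .refl _
    | symm _ h => exact .symm _ _ h
    | trans _ _ h₁ h₂ => exact .trans _ _ _ h₁ h₂

/-! ### The quotient magma -/

/-- `CombEqv` as a setoid. -/
def combSetoid : Setoid BTree := ⟨CombEqv, .refl, .symm, .trans⟩

/-- The magma of binary trees modulo `CombEqv`. -/
def CombMagma : Type := Quotient combSetoid

/-- The class of a binary tree in `CombMagma`. -/
def toMagma (t : BTree) : CombMagma := Quotient.mk combSetoid t

instance : Mul CombMagma :=
  ⟨Quotient.map₂ node fun _ _ h₁ _ _ h₂ => CombEqv.node h₁ h₂⟩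

theorem toMagma_eq_iff {t t' : BTree} : toMagma t = toMagma t' ↔ CombEqv t t' :=
  ⟨fun h => Quotient.exact h, fun h => Quotient.sound h⟩

theorem toMagma_node (l r : BTree) : toMagma (node l r) = toMagma l * toMagma r := rfl

namespace CombMagma

theorem leftComb_eq (a b c d : CombMagma) : ((a * b) * c) * d = a * (b * (c * d)) := by
  induction a using Quotient.inductionOn
  induction b using Quotient.inductionOn
  induction c using Quotient.inductionOn
  induction d using Quotient.inductionOn
  exact Quotient.sound (CombEqv.rule _ _ _ _)

theorem rightComb_mul (a b c d e : CombMagma) :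
    (a * (b * (c * d))) * e = (a * b) * (c * (d * e)) := by
  rw [← leftComb_eq a b c d, leftComb_eq (a * b) c d e]

theorem mul_mul_rightComb_mul (a b c d e f : CombMagma) :
    a * (b * ((c * (d * e)) * f)) = a * (b * (c * (d * (e * f)))) := by
  rw [← leftComb_eq a b (c * (d * e)) f, rightComb_mul (a * b) c d e f,
    leftComb_eq a b c (d * (e * f))]

theorem mul_rightComb_mul (a b c d e f : CombMagma) :
    a * ((b * (c * d)) * (e * f)) = a * (b * (c * (d * (e * f)))) := by
  rw [← leftComb_eq a (b * (c * d)) e f, rightComb_mul a b c d e, leftComb_eq a b (c * (d * e)) f,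
    mul_mul_rightComb_mul a b c d e f]

theorem mul_mul_cherry_mul (a b c d e f g : CombMagma) :
    a * (b * ((c * d) * (e * (f * g)))) = a * (b * (c * (d * ((e * f) * g)))) := by
  rw [← mul_mul_rightComb_mul a b (c * d) e f g, leftComb_eq c d (e * f) g]

theorem mul_cherry_mul (a b c d e f g : CombMagma) :
    a * ((b * c) * (d * (e * (f * g)))) = a * (b * (c * ((d * e) * (f * g)))) := by
  rw [← mul_rightComb_mul a (b * c) d e f g, leftComb_eq b c (d * e) (f * g)]

theorem mixedComb_mul (a b c d e f g : CombMagma) :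
    (a * ((b * c) * d)) * (e * (f * g)) = (a * b) * (c * (d * (e * (f * g)))) := by
  rw [← rightComb_mul a ((b * c) * d) e f g, leftComb_eq b c d (e * f),
    rightComb_mul a b c (d * (e * f)) g,
    mul_mul_rightComb_mul (a * b) c d e f g]

theorem mul_mul_mul_cherry_mul_leftComb (a b c d e f g h : CombMagma) :
    a * (b * (c * ((d * e) * ((f * g) * h)))) = a * (b * (c * (d * (e * (f * (g * h)))))) := by
  rw [← mul_mul_cherry_mul a b c (d * e) f g h, mul_mul_rightComb_mul a b c d e (f * (g * h))]

theorem mul_mul_mul_mul_cherry_mul_cherry (a b c d e f g h : CombMagma) :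
    a * (b * (c * (d * ((e * f) * (g * h))))) = a * (b * (c * (d * (e * ((f * g) * h))))) := by
  rw [← mul_mul_cherry_mul a b c d e f (g * h), ← mul_rightComb_mul a b (c * d) e f (g * h),
    mixedComb_mul b c d e f g h,
    mul_cherry_mul a b c d e f (g * h), mul_mul_cherry_mul b c d e f g h]

theorem cherry_mul_mul_mul_cherry_mul_cherry (a b c d e f g h : CombMagma) :
    (a * b) * (c * (d * ((e * f) * (g * h)))) = (a * b) * (c * (d * (e * ((f * g) * h)))) := by
  rw [← leftComb_eq d (e * f) g h, ← rightComb_mul a b c ((d * (e * f)) * g) h,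
    mul_mul_rightComb_mul b c d e f g,
    rightComb_mul a b c (d * (e * (f * g))) h, mul_mul_rightComb_mul (a * b) c d e (f * g) h]

theorem rightComb_two_mul (a b c d e f g h : CombMagma) :
    (a * (b * c)) * (d * (e * (f * (g * h)))) = (a * b) * (c * (d * (e * ((f * g) * h)))) := by
  rw [← rightComb_mul a (b * c) d e (f * (g * h)), mixedComb_mul a b c (d * e) f g h,
    mul_mul_cherry_mul (a * b) c d e f g h]

end CombMagma

/-! ### A certified normalization procedure -/

/-- Match a tree against a pattern, returning the subtrees at the leaves of the pattern. -/
def unify : BTree → BTree → Option (List BTree)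
  | leaf, t => some [t]
  | node _ _, leaf => none
  | node p q, node l r =>
    match unify p l, unify q r with
    | some xs, some ys => some (xs ++ ys)
    | _, _ => none

theorem length_of_unify {p t : BTree} {xs : List BTree} (h : unify p t = some xs) :
    xs.length = p.arity := by
  induction p generalizing t xs with
  | leaf => simp only [unify, Option.some.injEq] at h; subst h; rfl
  | node p q hp hq =>
    cases t with
    | leaf => simp [unify] at h
    | node l r =>
      simp only [unify] at h
      split at h
      · next ys zs h₁ h₂ =>
        cases h
        rw [List.length_append, hp h₁, hq h₂, arity]
      · cases h

theorem multigraft_of_unify {p t : BTree} {xs : List BTree} (h : unify p t = some xs) :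
    p.multigraft xs = t := by
  induction p generalizing t xs with
  | leaf => simp only [unify, Option.some.injEq] at h; subst h; rfl
  | node p q hp hq =>
    cases t with
    | leaf => simp [unify] at h
    | node l r =>
      simp only [unify] at h
      split at h
      · next ys zs h₁ h₂ =>
        cases h
        have hl := length_of_unify h₁
        rw [multigraft, ← hl, List.take_left, List.drop_left, hp h₁, hq h₂]
      · cases h

local infixr:65 "⋄" => node
local notation "∙" => leaf

/-- A convergent completion of the rule `((a b) c) d ⇒ a (b (c d))`. -/
def completion : List (BTree × BTree) :=
  [(((∙ ⋄ ∙) ⋄ ∙) ⋄ ∙, ∙ ⋄ ∙ ⋄ ∙ ⋄ ∙),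
   ((∙ ⋄ ∙ ⋄ ∙ ⋄ ∙) ⋄ ∙, (∙ ⋄ ∙) ⋄ ∙ ⋄ ∙ ⋄ ∙),
   (∙ ⋄ ∙ ⋄ (∙ ⋄ ∙ ⋄ ∙) ⋄ ∙, ∙ ⋄ ∙ ⋄ ∙ ⋄ ∙ ⋄ ∙ ⋄ ∙),
   (∙ ⋄ (∙ ⋄ ∙ ⋄ ∙) ⋄ ∙ ⋄ ∙, ∙ ⋄ ∙ ⋄ ∙ ⋄ ∙ ⋄ ∙ ⋄ ∙),
   (∙ ⋄ ∙ ⋄ (∙ ⋄ ∙) ⋄ ∙ ⋄ ∙ ⋄ ∙, ∙ ⋄ ∙ ⋄ ∙ ⋄ ∙ ⋄ (∙ ⋄ ∙) ⋄ ∙),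
   (∙ ⋄ (∙ ⋄ ∙) ⋄ ∙ ⋄ ∙ ⋄ ∙ ⋄ ∙, ∙ ⋄ ∙ ⋄ ∙ ⋄ (∙ ⋄ ∙) ⋄ ∙ ⋄ ∙),
   ((∙ ⋄ (∙ ⋄ ∙) ⋄ ∙) ⋄ ∙ ⋄ ∙ ⋄ ∙, (∙ ⋄ ∙) ⋄ ∙ ⋄ ∙ ⋄ ∙ ⋄ ∙ ⋄ ∙),
   (∙ ⋄ ∙ ⋄ ∙ ⋄ (∙ ⋄ ∙) ⋄ (∙ ⋄ ∙) ⋄ ∙, ∙ ⋄ ∙ ⋄ ∙ ⋄ ∙ ⋄ ∙ ⋄ ∙ ⋄ ∙ ⋄ ∙),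
   (∙ ⋄ ∙ ⋄ ∙ ⋄ ∙ ⋄ (∙ ⋄ ∙) ⋄ ∙ ⋄ ∙, ∙ ⋄ ∙ ⋄ ∙ ⋄ ∙ ⋄ ∙ ⋄ (∙ ⋄ ∙) ⋄ ∙),
   ((∙ ⋄ ∙) ⋄ ∙ ⋄ ∙ ⋄ (∙ ⋄ ∙) ⋄ ∙ ⋄ ∙, (∙ ⋄ ∙) ⋄ ∙ ⋄ ∙ ⋄ ∙ ⋄ (∙ ⋄ ∙) ⋄ ∙),
   ((∙ ⋄ ∙ ⋄ ∙) ⋄ ∙ ⋄ ∙ ⋄ ∙ ⋄ ∙ ⋄ ∙, (∙ ⋄ ∙) ⋄ ∙ ⋄ ∙ ⋄ ∙ ⋄ (∙ ⋄ ∙) ⋄ ∙)]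

theorem combEqv_of_mem_completion {p : BTree × BTree} (h : p ∈ completion) :
    CombEqv p.1 p.2 := by
  simp only [completion, List.mem_cons, List.not_mem_nil, or_false] at h
  rcases h with rfl | rfl | rfl | rfl | rfl | rfl | rfl | rfl | rfl | rfl | rfl <;>
    rw [← toMagma_eq_iff] <;> simp only [toMagma_node]
  · exact CombMagma.leftComb_eq _ _ _ _
  · exact CombMagma.rightComb_mul _ _ _ _ _
  · exact CombMagma.mul_mul_rightComb_mul _ _ _ _ _ _
  · exact CombMagma.mul_rightComb_mul _ _ _ _ _ _
  · exact CombMagma.mul_mul_cherry_mul _ _ _ _ _ _ _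
  · exact CombMagma.mul_cherry_mul _ _ _ _ _ _ _
  · exact CombMagma.mixedComb_mul _ _ _ _ _ _ _
  · exact CombMagma.mul_mul_mul_cherry_mul_leftComb _ _ _ _ _ _ _ _
  · exact CombMagma.mul_mul_mul_mul_cherry_mul_cherry _ _ _ _ _ _ _ _
  · exact CombMagma.cherry_mul_mul_mul_cherry_mul_cherry _ _ _ _ _ _ _ _
  · exact CombMagma.rightComb_two_mul _ _ _ _ _ _ _ _

/-- Rewrite a tree at its root with one of the rules of `completion`. -/
def rewriteRoot (t : BTree) : Option BTree :=
  completion.findSome? fun p => (unify p.1 t).map p.2.multigraft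

theorem combEqv_of_rewriteRoot {t t' : BTree} (h : rewriteRoot t = some t') : CombEqv t t' := by
  obtain ⟨p, hp, h⟩ := List.exists_of_findSome?_eq_some h
  obtain ⟨xs, hxs, rfl⟩ := Option.map_eq_some_iff.1 h
  rw [← multigraft_of_unify hxs]
  exact (combEqv_of_mem_completion hp).multigraft xs

/-- Normalize a tree with the rules of `completion`, up to recursion depth `k`. -/
def normalize : ℕ → BTree → BTree
  | 0, t => t
  | _ + 1, leaf => leaf
  | k + 1, node l r =>
    match rewriteRoot (node (normalize k l) (normalize k r)) with
    | some t => normalize k t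
    | none => node (normalize k l) (normalize k r)

theorem combEqv_normalize (k : ℕ) (t : BTree) : CombEqv t (normalize k t) := by
  induction k generalizing t with
  | zero => exact .refl _
  | succ k ih =>
    cases t with
    | leaf => exact .refl _
    | node l r =>
      simp only [normalize]
      split
      · next t' h =>
        exact ((CombEqv.node (ih l) (ih r)).trans (combEqv_of_rewriteRoot h)).trans (ih t')
      · exact .node (ih l) (ih r)

/-! ### Expansions: replacing a leaf by a cherry -/

/-- The trees obtained from a tree by replacing one leaf with the tree of arity two. -/
def expansions : BTree → List BTree
  | leaf => [node leaf leaf]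
  | node l r => (expansions l).map (node · r) ++ (expansions r).map (node l ·)

theorem mem_expansions_node {l r t : BTree} : t ∈ (node l r).expansions ↔
    (∃ l' ∈ l.expansions, t = node l' r) ∨ ∃ r' ∈ r.expansions, t = node l r' := by
  simp [expansions, eq_comm]

theorem mem_expansions_node_left {l l' : BTree} (h : l' ∈ l.expansions) (r : BTree) :
    node l' r ∈ (node l r).expansions :=
  mem_expansions_node.2 (.inl ⟨l', h, rfl⟩)

theorem mem_expansions_node_right {r r' : BTree} (h : r' ∈ r.expansions) (l : BTree) :
    node l r' ∈ (node l r).expansions :=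
  mem_expansions_node.2 (.inr ⟨r', h, rfl⟩)

theorem arity_of_mem_expansions {s t : BTree} (h : t ∈ s.expansions) :
    t.arity = s.arity + 1 := by
  induction s generalizing t with
  | leaf => simp only [expansions, List.mem_singleton] at h; subst h; rfl
  | node l r hl hr =>
    rcases mem_expansions_node.1 h with ⟨l', h', rfl⟩ | ⟨r', h', rfl⟩
    · simp only [arity, hl h']; omega
    · simp only [arity, hr h']; omega

theorem exists_mem_expansions {t : BTree} (h : t ≠ leaf) : ∃ s : BTree, t ∈ s.expansions := by
  induction t with
  | leaf => exact absurd rfl h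
  | node l r hl hr =>
    by_cases h₁ : l = leaf
    · by_cases h₂ : r = leaf
      · exact ⟨leaf, by simp [expansions, h₁, h₂]⟩
      · obtain ⟨s, hs⟩ := hr h₂
        exact ⟨_, mem_expansions_node_right hs l⟩
    · obtain ⟨s, hs⟩ := hl h₁
      exact ⟨_, mem_expansions_node_left hs r⟩

theorem CombEqv.exists_mem_expansions {s s' : BTree} (h : CombEqv s s') :
    (∀ t ∈ s.expansions, ∃ t' ∈ s'.expansions, CombEqv t t') ∧
      ∀ t' ∈ s'.expansions, ∃ t ∈ s.expansions, CombEqv t t' := by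
  induction h with
  | rule a b c d =>
    constructor <;> intro t ht
    · simp only [mem_expansions_node] at ht
      rcases ht with ⟨_, ⟨_, ⟨x, hx, rfl⟩ | ⟨x, hx, rfl⟩, rfl⟩ | ⟨x, hx, rfl⟩, rfl⟩ |
        ⟨x, hx, rfl⟩
      all_goals exact ⟨_, by simp [expansions, hx], .rule _ _ _ _⟩
    · simp only [mem_expansions_node] at ht
      rcases ht with ⟨x, hx, rfl⟩ | ⟨_, ⟨x, hx, rfl⟩ | ⟨_, ⟨x, hx, rfl⟩ | ⟨x, hx, rfl⟩, rfl⟩, rfl⟩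
      all_goals exact ⟨_, by simp [expansions, hx], .rule _ _ _ _⟩
  | node hl hr ihl ihr =>
    constructor <;> intro t ht <;>
      rcases mem_expansions_node.1 ht with ⟨x, hx, rfl⟩ | ⟨x, hx, rfl⟩
    · obtain ⟨y, hy, h⟩ := ihl.1 x hx
      exact ⟨_, mem_expansions_node_left hy _, .node h hr⟩
    · obtain ⟨y, hy, h⟩ := ihr.1 x hx
      exact ⟨_, mem_expansions_node_right hy _, .node hl h⟩
    · obtain ⟨y, hy, h⟩ := ihl.2 x hx
      exact ⟨_, mem_expansions_node_left hy _, .node h hr⟩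
    · obtain ⟨y, hy, h⟩ := ihr.2 x hx
      exact ⟨_, mem_expansions_node_right hy _, .node hl h⟩
  | refl => exact ⟨fun t ht => ⟨t, ht, .refl t⟩, fun t ht => ⟨t, ht, .refl t⟩⟩
  | symm _ ih =>
    refine ⟨fun t ht => ?_, fun t ht => ?_⟩
    · obtain ⟨y, hy, h⟩ := ih.2 t ht
      exact ⟨y, hy, h.symm⟩
    · obtain ⟨y, hy, h⟩ := ih.1 t ht
      exact ⟨y, hy, h.symm⟩
  | trans _ _ ih₁ ih₂ =>
    refine ⟨fun t ht => ?_, fun t ht => ?_⟩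
    · obtain ⟨y, hy, h⟩ := ih₁.1 t ht
      obtain ⟨z, hz, h'⟩ := ih₂.1 y hy
      exact ⟨z, hz, h.trans h'⟩
    · obtain ⟨y, hy, h⟩ := ih₂.2 t ht
      obtain ⟨z, hz, h'⟩ := ih₁.2 y hy
      exact ⟨z, hz, h'.trans h⟩

/-! ### Reducible trees -/

/-- A tree is reducible when it contains a left or a right comb with three internal nodes. -/
inductive Reducible : BTree → Prop
  | left {l : BTree} (r : BTree) : Reducible l → Reducible (node l r)
  | right (l : BTree) {r : BTree} : Reducible r → Reducible (node l r)
  | leftComb (a b c d : BTree) : Reducible (node (node (node a b) c) d)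
  | rightComb (a b c d : BTree) : Reducible (node a (node b (node c d)))

theorem not_reducible_leaf : ¬ Reducible leaf := nofun

theorem Reducible.four_le_arity {t : BTree} (h : Reducible t) : 4 ≤ t.arity := by
  induction h with
  | left r _ ih => simp only [arity]; omega
  | right l _ ih => simp only [arity]; omega
  | leftComb a b c d | rightComb a b c d =>
    have := a.arity_pos
    have := b.arity_pos
    have := c.arity_pos
    have := d.arity_pos
    simp only [arity]
    omega

theorem Reducible.combEqv_rightComb {t : BTree} (h : Reducible t) (ht : t.arity ≤ 4) :
    CombEqv t (BTree.rightComb 3) := by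
  cases h with
  | @left l r h =>
    have := h.four_le_arity
    have := r.arity_pos
    simp only [arity] at ht
    omega
  | @right l r h =>
    have := h.four_le_arity
    have := l.arity_pos
    simp only [arity] at ht
    omega
  | leftComb a b c d | rightComb a b c d =>
    have := a.arity_pos
    have := b.arity_pos
    have := c.arity_pos
    have := d.arity_pos
    simp only [arity] at ht
    rw [eq_leaf_of_arity_le_one (show a.arity ≤ 1 by omega),
      eq_leaf_of_arity_le_one (show b.arity ≤ 1 by omega),
      eq_leaf_of_arity_le_one (show c.arity ≤ 1 by omega),
      eq_leaf_of_arity_le_one (show d.arity ≤ 1 by omega)]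
    first
    | exact .rule _ _ _ _
    | exact .refl _

theorem Reducible.of_mem_expansions {s t : BTree} (hs : Reducible s) (h : t ∈ s.expansions) :
    Reducible t := by
  induction hs generalizing t with
  | left r hl ih =>
    rcases mem_expansions_node.1 h with ⟨x, hx, rfl⟩ | ⟨x, hx, rfl⟩
    · exact .left _ (ih hx)
    · exact .left _ hl
  | right l hr ih =>
    rcases mem_expansions_node.1 h with ⟨x, hx, rfl⟩ | ⟨x, hx, rfl⟩
    · exact .right _ hr
    · exact .right _ (ih hx)
  | leftComb a b c d =>
    simp only [mem_expansions_node] at h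
    rcases h with ⟨_, ⟨_, ⟨x, hx, rfl⟩ | ⟨x, hx, rfl⟩, rfl⟩ | ⟨x, hx, rfl⟩, rfl⟩ | ⟨x, hx, rfl⟩
    all_goals exact .leftComb _ _ _ _
  | rightComb a b c d =>
    simp only [mem_expansions_node] at h
    rcases h with ⟨x, hx, rfl⟩ | ⟨_, ⟨x, hx, rfl⟩ | ⟨_, ⟨x, hx, rfl⟩ | ⟨x, hx, rfl⟩, rfl⟩, rfl⟩
    all_goals exact .rightComb _ _ _ _

theorem Reducible.exists_combEqv_mem_expansions {t : BTree} (h : Reducible t)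
    (ht : 5 ≤ t.arity) :
    ∃ s t' : BTree, Reducible s ∧ t' ∈ s.expansions ∧ CombEqv t t' := by
  induction h with
  | @left l r h ih =>
    by_cases hl : 5 ≤ l.arity
    · obtain ⟨s, t', hs, ht', e⟩ := ih hl
      exact ⟨_, _, .left r hs, mem_expansions_node_left ht' r, .node e (.refl r)⟩
    by_cases hr : r = leaf
    · subst hr
      refine ⟨BTree.leftComb 3, BTree.leftComb 4, .leftComb _ _ _ _, by decide, ?_⟩
      exact .node ((h.combEqv_rightComb (by omega)).trans (CombEqv.rule _ _ _ _).symm) (.refl _)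
    · obtain ⟨s, hs⟩ := BTree.exists_mem_expansions hr
      exact ⟨_, _, .left s h, mem_expansions_node_right hs l, .refl _⟩
  | @right l r h ih =>
    by_cases hr : 5 ≤ r.arity
    · obtain ⟨s, t', hs, ht', e⟩ := ih hr
      exact ⟨_, _, .right l hs, mem_expansions_node_right ht' l, .node (.refl l) e⟩
    by_cases hl : l = leaf
    · subst hl
      refine ⟨BTree.rightComb 3, BTree.rightComb 4, .rightComb _ _ _ _, by decide, ?_⟩
      exact .node (.refl _) (h.combEqv_rightComb (by omega))
    · obtain ⟨s, hs⟩ := BTree.exists_mem_expansions hl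
      exact ⟨_, _, .right s h, mem_expansions_node_left hs r, .refl _⟩
  | leftComb a b c d =>
    have h : a ≠ leaf ∨ b ≠ leaf ∨ c ≠ leaf ∨ d ≠ leaf := by
      by_contra! h
      obtain ⟨rfl, rfl, rfl, rfl⟩ := h
      simp [arity] at ht
    rcases h with h | h | h | h <;> obtain ⟨s, hs⟩ := BTree.exists_mem_expansions h
    · exact ⟨_, _, .leftComb s b c d, by simp [expansions, hs], .refl _⟩
    · exact ⟨_, _, .leftComb a s c d, by simp [expansions, hs], .refl _⟩
    · exact ⟨_, _, .leftComb a b s d, by simp [expansions, hs], .refl _⟩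
    · exact ⟨_, _, .leftComb a b c s, by simp [expansions, hs], .refl _⟩
  | rightComb a b c d =>
    have h : a ≠ leaf ∨ b ≠ leaf ∨ c ≠ leaf ∨ d ≠ leaf := by
      by_contra! h
      obtain ⟨rfl, rfl, rfl, rfl⟩ := h
      simp [arity] at ht
    rcases h with h | h | h | h <;> obtain ⟨s, hs⟩ := BTree.exists_mem_expansions h
    · exact ⟨_, _, .rightComb s b c d, by simp [expansions, hs], .refl _⟩
    · exact ⟨_, _, .rightComb a s c d, by simp [expansions, hs], .refl _⟩
    · exact ⟨_, _, .rightComb a b s d, by simp [expansions, hs], .refl _⟩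
    · exact ⟨_, _, .rightComb a b c s, by simp [expansions, hs], .refl _⟩

/-- Normal forms representing every class of reducible trees of arity `k + 4`. -/
def reducibleReps : ℕ → List BTree
  | 0 => [rightComb 3]
  | k + 1 => (((reducibleReps k).flatMap expansions).map (normalize 40)).dedup

theorem Reducible.exists_mem_reducibleReps {k : ℕ} {t : BTree} (h : Reducible t)
    (ht : t.arity = k + 4) : ∃ s ∈ reducibleReps k, CombEqv t s := by
  induction k generalizing t with
  | zero => exact ⟨_, List.mem_singleton.2 rfl, h.combEqv_rightComb (by omega)⟩
  | succ k ih =>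
    obtain ⟨s, t', hs, ht', e⟩ := h.exists_combEqv_mem_expansions (by omega)
    have ha := arity_of_mem_expansions ht'
    rw [← e.arity_eq] at ha
    obtain ⟨s', hs', e'⟩ := ih hs (by omega)
    obtain ⟨t'', ht'', e''⟩ := e'.exists_mem_expansions.1 t' ht'
    refine ⟨normalize 40 t'', ?_, (e.trans e'').trans (combEqv_normalize _ _)⟩
    rw [reducibleReps, List.mem_dedup]
    exact List.mem_map_of_mem (List.mem_flatMap.2 ⟨s', hs', ht''⟩)

/-- The tree `∙ (∙ (⋯ (∙ x)))` with `x` a tree of arity three selected by `f`, preceded by `k`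
leaves. -/
def dots (f : Bool) : ℕ → BTree
  | 0 => if f then node (node leaf leaf) leaf else node leaf (node leaf leaf)
  | k + 1 => node leaf (dots f k)

/-- The four normal forms of the reducible trees of arity `m + 5`. -/
def reducibleForm (m : ℕ) (e f : Bool) : BTree :=
  if e then node (node leaf leaf) (dots f m) else dots f (m + 2)

theorem exists_eq_reducibleForm_of_mem_reducibleReps_seven :
    ∀ t ∈ reducibleReps 7, ∃ e f, t = reducibleForm 6 e f := by
  decide +kernel

theorem exists_normalize_eq_reducibleForm_of_mem_expansions :
    ∀ e f, ∀ t ∈ (reducibleForm 6 e f).expansions, ∃ e' f',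
      normalize 40 t = reducibleForm 7 e' f' := by
  decide +kernel

theorem arity_dots (f : Bool) (k : ℕ) : (dots f k).arity = k + 3 := by
  induction k with
  | zero => cases f <;> rfl
  | succ k ih => simp only [dots, arity, ih]; omega

theorem arity_reducibleForm (m : ℕ) (e f : Bool) : (reducibleForm m e f).arity = m + 5 := by
  cases e <;> simp +arith [reducibleForm, arity, arity_dots]

theorem reducible_dots (f : Bool) (k : ℕ) : Reducible (dots f (k + 2)) := by
  cases k with
  | zero => cases f <;> exact .rightComb _ _ _ _
  | succ k => exact .rightComb _ _ _ _

theorem reducible_reducibleForm (m : ℕ) (e f : Bool) :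
    Reducible (reducibleForm (m + 2) e f) := by
  cases e
  · exact reducible_dots f (m + 2)
  · exact .right _ (reducible_dots f m)

/-! ### Reduction of the expansions of the normal forms -/

local notation "□" => toMagma leaf

theorem toMagma_dots_succ (f : Bool) (k : ℕ) :
    toMagma (dots f (k + 1)) = □ * toMagma (dots f k) := rfl

theorem mul_cherry_mul_dots_aux (a : CombMagma) (f : Bool) (k : ℕ) :
    a * (□ * (□ * (□ * ((□ * □) * toMagma (dots f k))))) = a * toMagma (dots (!f) (k + 5)) := by
  induction k generalizing a with
  | zero =>
    cases f
    · change a * (□ * (□ * (□ * ((□ * □) * (□ * (□ * □)))))) =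
        a * (□ * (□ * (□ * (□ * (□ * ((□ * □) * □))))))
      rw [CombMagma.mul_mul_mul_mul_cherry_mul_cherry a □ □ □ □ □ □ (□ * □),
    CombMagma.mul_mul_mul_mul_cherry_mul_cherry □ □ □ □ □ □ □ □]
    · change a * (□ * (□ * (□ * ((□ * □) * ((□ * □) * □))))) =
        a * (□ * (□ * (□ * (□ * (□ * (□ * (□ * □)))))))
      rw [CombMagma.mul_mul_mul_cherry_mul_leftComb □ □ □ □ □ □ □ □]
  | succ k ih =>
    rw [toMagma_dots_succ, CombMagma.mul_mul_mul_mul_cherry_mul_cherry a □ □ □ □ □ □, ih □,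
    Nat.add_right_comm k 1 5]
    rfl

theorem mul_cherry_mul_dots (a : CombMagma) (f : Bool) {k : ℕ} (hk : 5 ≤ k) :
    a * ((□ * □) * toMagma (dots f k)) = a * toMagma (dots (!f) (k + 2)) := by
  obtain ⟨k, rfl⟩ := Nat.exists_eq_add_of_le' hk
  calc
    _ = a * ((□ * □) * (□ * (□ * (□ * toMagma (dots f (k + 2)))))) := rfl
    _ = a * (□ * (□ * ((□ * □) * (□ * (□ * (□ * toMagma (dots f k))))))) :=
      CombMagma.mul_cherry_mul _ _ _ _ _ _ _
    _ = a * (□ * (□ * (□ * (□ * ((□ * □) * toMagma (dots f (k + 1))))))) := by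
      rw [CombMagma.mul_cherry_mul □ □ □ □ □ □, ← toMagma_dots_succ]
    _ = _ := by
      rw [mul_cherry_mul_dots_aux □ f (k + 1), Nat.add_right_comm k 1 5]
      rfl

theorem rightComb_two_mul_dots (f : Bool) {k : ℕ} (hk : 4 ≤ k) :
    (□ * (□ * □)) * toMagma (dots f k) = (□ * □) * toMagma (dots (!f) (k + 1)) := by
  obtain ⟨k, rfl⟩ := Nat.exists_eq_add_of_le' hk
  exact (CombMagma.rightComb_two_mul _ _ _ _ _ _ _ _).trans (mul_cherry_mul_dots_aux _ _ _)

theorem exists_combEqv_reducibleForm_of_mem_expansions {m : ℕ} (hm : 5 ≤ m)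
    (ih : ∀ t : BTree, Reducible t → t.arity = m + 5 → ∃ e f, CombEqv t (reducibleForm m e f))
    (ih' : ∀ t : BTree, Reducible t → t.arity = m + 6 →
      ∃ e f, CombEqv t (reducibleForm (m + 1) e f))
    {e f : Bool} {t : BTree} (ht : t ∈ (reducibleForm (m + 1) e f).expansions) :
    ∃ e f, CombEqv t (reducibleForm (m + 2) e f) := by
  obtain ⟨k, rfl⟩ := Nat.exists_eq_add_of_le' hm
  cases e
  · change t ∈ (node leaf (dots f (k + 5 + 2))).expansions at ht
    rcases mem_expansions_node.1 ht with ⟨x, hx, rfl⟩ | ⟨x, hx, rfl⟩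
    · rw [expansions, List.mem_singleton] at hx
      subst hx
      exact ⟨true, f, .refl _⟩
    · obtain ⟨e', f', h⟩ := ih' x ((reducible_dots f _).of_mem_expansions hx)
        (by rw [arity_of_mem_expansions hx, arity_dots])
      have h' := CombEqv.node (.refl leaf) h
      cases e'
      · exact ⟨false, f', h'⟩
      · exact ⟨false, !f', h'.trans (toMagma_eq_iff.1 (mul_cherry_mul_dots □ f' (by omega)))⟩
  · change t ∈ (node (node leaf leaf) (dots f (k + 4 + 2))).expansions at ht
    rcases mem_expansions_node.1 ht with ⟨x, hx, rfl⟩ | ⟨x, hx, rfl⟩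
    · simp only [expansions, List.map_cons, List.map_nil, List.cons_append, List.nil_append,
        List.mem_cons, List.not_mem_nil, or_false] at hx
      rcases hx with rfl | rfl
      · exact ⟨false, f, .rule _ _ _ _⟩
      · exact ⟨true, !f, toMagma_eq_iff.1 (rightComb_two_mul_dots f (by omega))⟩
    · obtain ⟨e', f', h⟩ := ih x ((reducible_dots f _).of_mem_expansions hx)
        (by rw [arity_of_mem_expansions hx, arity_dots])
      have h' := CombEqv.node (.refl (node leaf leaf)) h
      cases e'
      · exact ⟨true, f', h'⟩
      · exact ⟨true, !f',
          h'.trans (toMagma_eq_iff.1 (mul_cherry_mul_dots (□ * □) f' (by omega)))⟩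

theorem Reducible.exists_combEqv_reducibleForm {m : ℕ} (hm : 6 ≤ m) {t : BTree}
    (h : Reducible t) (ht : t.arity = m + 5) : ∃ e f, CombEqv t (reducibleForm m e f) := by
  induction m using Nat.strong_induction_on generalizing t with
  | _ m ih =>
    obtain rfl | hm : m = 6 ∨ 7 ≤ m := by omega
    · obtain ⟨s, hs, hts⟩ := h.exists_mem_reducibleReps (k := 7) ht
      obtain ⟨e, f, rfl⟩ := exists_eq_reducibleForm_of_mem_reducibleReps_seven s hs
      exact ⟨e, f, hts⟩
    · obtain ⟨k, rfl⟩ := Nat.exists_eq_add_of_le' (show 2 ≤ m by omega)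
      obtain ⟨s, t', hs, ht', htt'⟩ := h.exists_combEqv_mem_expansions (by omega)
      have ha := arity_of_mem_expansions ht'
      rw [← htt'.arity_eq] at ha
      obtain ⟨e, f, hsf⟩ := ih (k + 1) (by omega) (by omega) hs (by omega)
      obtain ⟨t'', ht'', htt''⟩ := hsf.exists_mem_expansions.1 t' ht'
      suffices h' : ∃ e' f', CombEqv t'' (reducibleForm (k + 2) e' f') by
        obtain ⟨e', f', h'⟩ := h'
        exact ⟨e', f', (htt'.trans htt'').trans h'⟩
      obtain rfl | hk : k = 5 ∨ 6 ≤ k := by omega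
      · obtain ⟨e', f', h'⟩ := exists_normalize_eq_reducibleForm_of_mem_expansions e f t'' ht''
        exact ⟨e', f', h' ▸ combEqv_normalize 40 t''⟩
      · exact exists_combEqv_reducibleForm_of_mem_expansions (by omega)
          (fun t h => ih k (by omega) hk h) (fun t h => ih (k + 1) (by omega) (by omega) h) ht''

/-! ### Irreducible trees -/

/-- The zigzag with `k` internal nodes, whose root has a leaf as its right child if `b` holds and
as its left child otherwise. -/
def zigzag : Bool → ℕ → BTree
  | _, 0 => leaf
  | false, k + 1 => node leaf (zigzag true k)
  | true, k + 1 => node (zigzag false k) leaf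

theorem arity_zigzag (b : Bool) (k : ℕ) : (zigzag b k).arity = k + 1 := by
  induction k generalizing b with
  | zero => cases b <;> rfl
  | succ k ih =>
    cases b <;> simp only [zigzag, arity, ih]
    omega

theorem arity_eq_degree_add_one (t : BTree) : t.arity = t.degree + 1 := by
  induction t with
  | leaf => rfl
  | node l r hl hr => simp only [arity, degree, hl, hr]; omega

theorem reducible_node_iff {l r : BTree} : Reducible (node l r) ↔
    Reducible l ∨ Reducible r ∨ (∃ a b c, l = node (node a b) c) ∨
      ∃ a b c, r = node a (node b c) := by
  constructor
  · rintro (⟨_, h⟩ | ⟨_, h⟩ | _ | _)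
    · exact .inl h
    · exact .inr (.inl h)
    · exact .inr (.inr (.inl ⟨_, _, _, rfl⟩))
    · exact .inr (.inr (.inr ⟨_, _, _, rfl⟩))
  · rintro (h | h | ⟨_, _, _, rfl⟩ | ⟨_, _, _, rfl⟩)
    · exact .left _ h
    · exact .right _ h
    · exact .leftComb _ _ _ _
    · exact .rightComb _ _ _ _

theorem zigzag_false_ne (k : ℕ) (a b c : BTree) : zigzag false k ≠ node (node a b) c := by
  cases k <;> simp [zigzag]

theorem zigzag_true_ne (k : ℕ) (a b c : BTree) : zigzag true k ≠ node a (node b c) := by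
  cases k <;> simp [zigzag]

theorem not_reducible_zigzag (b : Bool) (k : ℕ) : ¬ Reducible (zigzag b k) := by
  induction k generalizing b with
  | zero => cases b <;> exact not_reducible_leaf
  | succ k ih =>
    cases b <;>
      simp [zigzag, reducible_node_iff, ih, not_reducible_leaf, zigzag_false_ne, zigzag_true_ne]

theorem not_reducible_node_zigzag (i j : ℕ) :
    ¬ Reducible (node (zigzag false i) (zigzag true j)) := by
  simp [reducible_node_iff, not_reducible_zigzag, zigzag_false_ne, zigzag_true_ne]

theorem eq_zigzag_of_not_reducible_node (t : BTree) :
    (∀ c, ¬ Reducible (node t c) → t = zigzag false t.degree) ∧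
      ∀ c, ¬ Reducible (node c t) → t = zigzag true t.degree := by
  induction t with
  | leaf => exact ⟨fun _ _ => rfl, fun _ _ => rfl⟩
  | node l r hl hr =>
    refine ⟨fun c h => ?_, fun c h => ?_⟩
    · cases l with
      | leaf =>
        rw [degree, degree, Nat.zero_add, zigzag, ← hr.2 leaf fun h' => h (.left c h')]
      | node a b => exact absurd (.leftComb a b r c) h
    · cases r with
      | leaf =>
        rw [degree, degree, Nat.add_zero, zigzag, ← hl.1 leaf fun h' => h (.right c h')]
      | node a b => exact absurd (.rightComb c l a b) h

theorem eq_node_zigzag_of_not_reducible {n : ℕ} {t : BTree} (h : ¬ Reducible t)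
    (ht : t.arity = n + 2) :
    ∃ i ≤ n, t = node (zigzag false i) (zigzag true (n - i)) := by
  cases t with
  | leaf => simp [arity] at ht
  | node l r =>
    simp only [arity, arity_eq_degree_add_one] at ht
    refine ⟨l.degree, by omega, ?_⟩
    rw [← (eq_zigzag_of_not_reducible_node l).1 r h, show n - l.degree = r.degree by omega,
      ← (eq_zigzag_of_not_reducible_node r).2 l h]

/-! ### Invariants -/

theorem CombEqv.leftRank_mod_two {t t' : BTree} (h : CombEqv t t') :
    t.leftRank % 2 = t'.leftRank % 2 := by
  induction h with
  | rule => simp only [leftRank]; omega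
  | node _ _ h _ => simp only [leftRank]; omega
  | refl => rfl
  | symm _ h => exact h.symm
  | trans _ _ h₁ h₂ => exact h₁.trans h₂

theorem CombEqv.leftRank_mirror_mod_two {t t' : BTree} (h : CombEqv t t') :
    t.mirror.leftRank % 2 = t'.mirror.leftRank % 2 := by
  induction h with
  | rule => simp only [mirror, leftRank]; omega
  | node _ _ _ h => simp only [mirror, leftRank]; omega
  | refl => rfl
  | symm _ h => exact h.symm
  | trans _ _ h₁ h₂ => exact h₁.trans h₂

theorem CombEqv.eq_or_reducible {t t' : BTree} (h : CombEqv t t') :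
    t = t' ∨ Reducible t ∧ Reducible t' := by
  induction h with
  | rule => exact .inr ⟨.leftComb _ _ _ _, .rightComb _ _ _ _⟩
  | node _ _ h₁ h₂ =>
    rcases h₁ with rfl | ⟨h, h'⟩
    · rcases h₂ with rfl | ⟨h, h'⟩
      · exact .inl rfl
      · exact .inr ⟨.right _ h, .right _ h'⟩
    · exact .inr ⟨.left _ h, .left _ h'⟩
  | refl => exact .inl rfl
  | symm _ h => exact h.imp Eq.symm And.symm
  | trans _ _ h₁ h₂ =>
    rcases h₁ with rfl | ⟨h, h'⟩
    · exact h₂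
    · rcases h₂ with rfl | ⟨_, h''⟩
      · exact .inr ⟨h, h'⟩
      · exact .inr ⟨h, h''⟩

theorem leftRank_reducibleForm (m : ℕ) (e f : Bool) :
    (reducibleForm m e f).leftRank = 1 + e.toNat := by
  cases e <;> rfl

theorem leftRank_mirror_dots (f : Bool) (k : ℕ) :
    (dots f k).mirror.leftRank = k + 1 + (!f).toNat := by
  induction k with
  | zero => cases f <;> rfl
  | succ k ih => simp only [dots, mirror, leftRank, ih]; omega

theorem leftRank_mirror_reducibleForm (m : ℕ) (e f : Bool) :
    (reducibleForm m e f).mirror.leftRank = m + 3 - e.toNat + (!f).toNat := by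
  cases e <;> simp [reducibleForm, mirror, leftRank, leftRank_mirror_dots]
  omega

theorem reducibleForm_combEqv_iff {m : ℕ} {e f e' f' : Bool} :
    CombEqv (reducibleForm m e f) (reducibleForm m e' f') ↔ e = e' ∧ f = f' := by
  refine ⟨fun h => ?_, by rintro ⟨rfl, rfl⟩; exact .refl _⟩
  have h₁ := h.leftRank_mod_two
  have h₂ := h.leftRank_mirror_mod_two
  rw [leftRank_reducibleForm, leftRank_reducibleForm] at h₁
  rw [leftRank_mirror_reducibleForm, leftRank_mirror_reducibleForm] at h₂
  cases e <;> cases e' <;> cases f <;> cases f' <;> simp at h₁ h₂ ⊢ <;> omega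

/-! ### Counting the classes -/

/-- Representatives of the classes of trees of arity `m + 5`. -/
def classRep (m : ℕ) : Fin (m + 4) ⊕ Bool × Bool → {t : BTree // t.arity = m + 5}
  | .inl i => ⟨node (zigzag false i) (zigzag true (m + 3 - i)), by
      simp only [arity, arity_zigzag]; omega⟩
  | .inr (e, f) => ⟨reducibleForm m e f, arity_reducibleForm m e f⟩

theorem injective_classRep {m : ℕ} (hm : 2 ≤ m) {x y : Fin (m + 4) ⊕ Bool × Bool}
    (h : CombEqv (classRep m x) (classRep m y)) : x = y := by
  obtain ⟨m, rfl⟩ := Nat.exists_eq_add_of_le' hm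
  rcases x with i | ⟨e, f⟩ <;> rcases y with j | ⟨e', f'⟩
  · rcases h.eq_or_reducible with h | ⟨h, -⟩
    · have h' := congrArg arity (node.inj h).1
      rw [arity_zigzag, arity_zigzag] at h'
      rw [Fin.ext (Nat.succ_injective h')]
    · exact absurd h (not_reducible_node_zigzag _ _)
  · rcases h.eq_or_reducible with h | ⟨h, -⟩
    · exact (not_reducible_node_zigzag _ _ (h.symm.subst (reducible_reducibleForm m e' f'))).elim
    · exact absurd h (not_reducible_node_zigzag _ _)
  · rcases h.eq_or_reducible with h | ⟨-, h⟩
    · exact (not_reducible_node_zigzag _ _ (h.subst (reducible_reducibleForm m e f))).elim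
    · exact absurd h (not_reducible_node_zigzag _ _)
  · obtain ⟨rfl, rfl⟩ := reducibleForm_combEqv_iff.1 h
    rfl

theorem exists_combEqv_classRep {m : ℕ} (hm : 6 ≤ m) {t : BTree} (ht : t.arity = m + 5) :
    ∃ x, CombEqv (classRep m x) t := by
  by_cases h : Reducible t
  · obtain ⟨e, f, h⟩ := h.exists_combEqv_reducibleForm hm ht
    exact ⟨.inr (e, f), h.symm⟩
  · obtain ⟨i, hi, rfl⟩ := eq_node_zigzag_of_not_reducible (n := m + 3) h ht
    exact ⟨.inl ⟨i, by omega⟩, .refl _⟩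

end BTree

/-- For `n ≥ 11`, the number of `≡₃`-classes of binary trees of arity `n` is `n + 3`. -/
theorem stmt11 (n : ℕ) (hn : 11 ≤ n) : classCount (CAsCongr 3) n = n + 3 := by
  obtain ⟨m, rfl⟩ := Nat.exists_eq_add_of_le' (show 5 ≤ n by omega)
  have hequiv : Equivalence fun a b : {t : BTree // t.arity = m + 5} => CAsCongr 3 a.1 b.1 :=
    (Relation.EqvGen.is_equivalence _).comap Subtype.val
  have hbij : Function.Bijective fun x => Quot.mk
      (fun a b : {t : BTree // t.arity = m + 5} => CAsCongr 3 a.1 b.1) (BTree.classRep m x) := by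
    constructor
    · intro x y h
      exact BTree.injective_classRep (by omega)
        (BTree.cAsCongr_three_iff.1 (hequiv.quot_mk_eq_iff _ _ |>.1 h))
    · rintro ⟨t, ht⟩
      obtain ⟨x, hx⟩ := BTree.exists_combEqv_classRep (by omega) ht
      exact ⟨x, Quot.sound (BTree.cAsCongr_three_iff.2 hx)⟩
  rw [classCount, ← Nat.card_eq_of_bijective _ hbij]
  simp [Nat.card_eq_fintype_card]
end

section
/- Each of the following one-rule rewrite systems on binary trees induces a rewrite relation that is both terminating and confluent: a_2 → a_1; a_4 → a_5; a_3 → a_1; a_3 → a_5; a_4 → a_1; a_2 → a_5; a_2 → a_4; and a_4 → a_2. Consequently, these rules are convergent presentations of the quotient operads Mag^{{1,2}}, Mag^{{4,5}}, Mag^{{1,3}}, Mag^{{3,5}}, Mag^{{1,4}}, Mag^{{2,5}}, and Mag^{{2,4}} (the last two rules both presenting Mag^{{2,4}}). -/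
/-- The five binary trees of degree `3`, in increasing lexicographic order of
their prefix words: `cubic 1` has prefix word `2020200` (the right comb), …,
`cubic 5` has prefix word `2220000` (the left comb). -/
def cubic : ℕ → BTree
  | 1 => .node .leaf (.node .leaf (.node .leaf .leaf))
  | 2 => .node .leaf (.node (.node .leaf .leaf) .leaf)
  | 3 => .node (.node .leaf .leaf) (.node .leaf .leaf)
  | 4 => .node (.node .leaf (.node .leaf .leaf)) .leaf
  | 5 => .node (.node (.node .leaf .leaf) .leaf) .leaf
  | _ => .leaf

/-- The congruence `≡_{i,j}` generated by the single rewrite rule `(𝔞_i, 𝔞_j)`. -/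
def MagCongr (i j : ℕ) : BTree → BTree → Prop :=
  CongrGen fun s s' => s = cubic i ∧ s' = cubic j

namespace BTree

/-- The instance of the pattern `cubic k` whose four leaves carry `x`, `y`, `z`, `w`. -/
def cubicInst (k : ℕ) (x y z w : BTree) : BTree :=
  match k with
  | 1 => node x (node y (node z w))
  | 2 => node x (node (node y z) w)
  | 3 => node (node x y) (node z w)
  | 4 => node (node x (node y z)) w
  | 5 => node (node (node x y) z) w
  | _ => leaf

/-- A weighted size of trees, the left and right subtrees of a node counting with
multiplicities `p` and `q`. -/
def weight (p q : ℕ) : BTree → ℕ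
  | leaf => 1
  | node l r => p * weight p q l + q * weight p q r

lemma weight_pos {p : ℕ} (hp : 0 < p) (q : ℕ) (t : BTree) : 0 < weight p q t := by
  induction t with
  | leaf => simp [weight]
  | node l r ihl ihr => simp only [weight]; positivity

lemma mirror_mirror (t : BTree) : t.mirror.mirror = t := by
  induction t with
  | leaf => rfl
  | node l r ihl ihr => simp [mirror, ihl, ihr]

end BTree

open BTree Relation

/-- The one-step rewriting relation of the rule `cubic i → cubic j`, presented as the closure
of the instances of the rule under left and right contexts. -/
inductive CubicStep (i j : ℕ) : BTree → BTree → Prop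
  | rule {s t : BTree} (x y z w : BTree) (hs : s = cubicInst i x y z w)
      (ht : t = cubicInst j x y z w) : CubicStep i j s t
  | left {s t : BTree} (u : BTree) (h : CubicStep i j s t) :
      CubicStep i j (node s u) (node t u)
  | right {s t : BTree} (u : BTree) (h : CubicStep i j s t) :
      CubicStep i j (node u s) (node u t)

lemma exists_multigraft_cubic {k : ℕ} (hk : k ∈ Finset.Icc 1 5) (rs : List BTree)
    (h : rs.length = 4) : ∃ x y z w, rs = [x, y, z, w] ∧
      (cubic k).multigraft rs = cubicInst k x y z w := by
  match rs, h with
  | [x, y, z, w], _ =>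
    refine ⟨x, y, z, w, rfl, ?_⟩
    fin_cases hk <;> rfl

lemma arity_cubic {k : ℕ} (hk : k ∈ Finset.Icc 1 5) : (cubic k).arity = 4 := by
  fin_cases hk <;> rfl

lemma CubicStep.graft {i j : ℕ} {s t : BTree} (h : CubicStep i j s t) (r : BTree) {m : ℕ}
    (h₁ : 1 ≤ m) (h₂ : m ≤ r.arity) : CubicStep i j (r.graft m s) (r.graft m t) := by
  induction r generalizing m with
  | leaf =>
    obtain rfl : m = 1 := le_antisymm h₂ h₁
    simpa [BTree.graft] using h
  | node l r ihl ihr =>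
    simp only [arity] at h₂
    by_cases hm : m ≤ l.arity
    · simpa [BTree.graft, hm] using CubicStep.left r (ihl h₁ hm)
    · simpa [BTree.graft, hm] using CubicStep.right l (ihr (m := m - l.arity) (by omega) (by omega))

lemma step_iff_cubicStep {i j : ℕ} (hi : i ∈ Finset.Icc 1 5) (hj : j ∈ Finset.Icc 1 5)
    (t t' : BTree) :
    Step (fun s s' => s = cubic i ∧ s' = cubic j) t t' ↔ CubicStep i j t t' := by
  constructor
  · rintro ⟨_, _, r, m, rs, ⟨rfl, rfl⟩, h₁, h₂, hrs, rfl, rfl⟩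
    rw [arity_cubic hi] at hrs
    obtain ⟨x, y, z, w, rfl, hx⟩ := exists_multigraft_cubic hi rs hrs
    obtain ⟨x', y', z', w', he, hx'⟩ := exists_multigraft_cubic hj _ hrs
    simp only [List.cons.injEq, and_true] at he
    obtain ⟨rfl, rfl, rfl, rfl⟩ := he
    exact CubicStep.graft (.rule x y z w hx hx') r h₁ h₂
  · intro h
    induction h with
    | rule x y z w hs ht =>
      subst hs ht
      refine ⟨_, _, leaf, 1, [x, y, z, w], ⟨rfl, rfl⟩, le_rfl, le_rfl,
        (arity_cubic hi).symm, ?_, ?_⟩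
      · fin_cases hi <;> rfl
      · fin_cases hj <;> rfl
    | left u _ ih =>
      obtain ⟨s, s', r, m, rs, hR, h₁, h₂, hrs, rfl, rfl⟩ := ih
      refine ⟨s, s', node r u, m, rs, hR, h₁, ?_, hrs, ?_, ?_⟩
      · simp only [arity]; omega
      · simp [BTree.graft, h₂]
      · simp [BTree.graft, h₂]
    | right u _ ih =>
      obtain ⟨s, s', r, m, rs, hR, h₁, h₂, hrs, rfl, rfl⟩ := ih
      have hm : ¬ m + u.arity ≤ u.arity := by omega
      refine ⟨s, s', node u r, m + u.arity, rs, hR, by omega, ?_, hrs, ?_, ?_⟩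
      · simp only [arity]; omega
      · simp [BTree.graft, hm]
      · simp [BTree.graft, hm]

lemma CubicStep.node_iff {i j : ℕ} {l r c : BTree} : CubicStep i j (node l r) c ↔
    (∃ x y z w, node l r = cubicInst i x y z w ∧ c = cubicInst j x y z w) ∨
    (∃ l', CubicStep i j l l' ∧ c = node l' r) ∨ ∃ r', CubicStep i j r r' ∧ c = node l r' := by
  constructor
  · intro h
    cases h with
    | rule x y z w hs ht => exact .inl ⟨x, y, z, w, hs, ht⟩
    | left _ h => exact .inr (.inl ⟨_, h, rfl⟩)
    | right _ h => exact .inr (.inr ⟨_, h, rfl⟩)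
  · rintro (⟨x, y, z, w, hs, ht⟩ | ⟨l', h, rfl⟩ | ⟨r', h, rfl⟩)
    exacts [.rule x y z w hs ht, .left _ h, .right _ h]

lemma cubicInst_mirror {i : ℕ} (hi : i ∈ Finset.Icc 1 5) (x y z w : BTree) :
    (cubicInst i x y z w).mirror = cubicInst (6 - i) w.mirror z.mirror y.mirror x.mirror := by
  fin_cases hi <;> rfl

lemma CubicStep.mirror {i j : ℕ} (hi : i ∈ Finset.Icc 1 5) (hj : j ∈ Finset.Icc 1 5)
    {s t : BTree} (h : CubicStep i j s t) :
    CubicStep (6 - i) (6 - j) s.mirror t.mirror := by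
  induction h with
  | rule x y z w hs ht =>
    subst hs ht
    exact .rule _ _ _ _ (cubicInst_mirror hi x y z w) (cubicInst_mirror hj x y z w)
  | left u _ ih => exact .right _ ih
  | right u _ ih => exact .left _ ih

/-- Newman's lemma: a terminating and locally confluent relation is confluent. -/
lemma join_of_locally_confluent {α : Type*} {r : α → α → Prop}
    (hwf : WellFounded fun a b => r b a)
    (hloc : ∀ a b c, r a b → r a c → Join (ReflTransGen r) b c) (a b c : α)
    (hab : ReflTransGen r a b) (hac : ReflTransGen r a c) : Join (ReflTransGen r) b c := by
  induction a using hwf.induction generalizing b c with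
  | _ a ih =>
    rcases hab.cases_head with rfl | ⟨b₁, hab₁, hb₁b⟩
    · exact ⟨c, hac, .refl⟩
    rcases hac.cases_head with rfl | ⟨c₁, hac₁, hc₁c⟩
    · exact ⟨b, .refl, hab⟩
    obtain ⟨d, hb₁d, hc₁d⟩ := hloc a b₁ c₁ hab₁ hac₁
    obtain ⟨e, hbe, hde⟩ := ih b₁ hab₁ b d hb₁b hb₁d
    obtain ⟨f, hef, hcf⟩ := ih c₁ hac₁ e c (hc₁d.trans hde) hc₁c
    exact ⟨f, hbe.trans hef, hcf⟩

/-- It suffices to check local confluence on peaks one of whose steps is at the root. -/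
lemma CubicStep.locally_confluent {i j : ℕ}
    (hroot : ∀ x y z w c, CubicStep i j (cubicInst i x y z w) c →
      Join (ReflTransGen (CubicStep i j)) (cubicInst j x y z w) c) (a b c : BTree)
    (hab : CubicStep i j a b) (hac : CubicStep i j a c) :
    Join (ReflTransGen (CubicStep i j)) b c := by
  induction hab generalizing c with
  | rule x y z w hs ht => subst hs ht; exact hroot x y z w c hac
  | left u h ih =>
    cases hac with
    | rule x y z w hs ht =>
      subst ht
      exact Std.Symm.symm _ _ (hroot x y z w _ (hs ▸ .left u h))
    | left _ h' =>
      obtain ⟨d, h₁, h₂⟩ := ih _ h'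
      exact ⟨node d u, h₁.lift (node · u) fun _ _ => .left u,
        h₂.lift (node · u) fun _ _ => .left u⟩
    | right _ h' => exact ⟨_, .single (.right _ h'), .single (.left _ h)⟩
  | right u h ih =>
    cases hac with
    | rule x y z w hs ht =>
      subst ht
      exact Std.Symm.symm _ _ (hroot x y z w _ (hs ▸ .right u h))
    | left _ h' => exact ⟨_, .single (.left _ h'), .single (.right _ h)⟩
    | right _ h' =>
      obtain ⟨d, h₁, h₂⟩ := ih _ h'
      exact ⟨node u d, h₁.lift (node u ·) fun _ _ => .right u,
        h₂.lift (node u ·) fun _ _ => .right u⟩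

lemma CubicStep.weight_lt {i j : ℕ}
    (hroot : ∀ x y z w, weight 2 1 (cubicInst j x y z w) < weight 2 1 (cubicInst i x y z w))
    {s t : BTree} (h : CubicStep i j s t) : weight 2 1 t < weight 2 1 s := by
  induction h with
  | rule x y z w hs ht => subst hs ht; exact hroot x y z w
  | left u _ ih => simp only [weight]; omega
  | right u _ ih => simp only [weight]; omega

lemma CubicStep.wellFounded {i j : ℕ}
    (h : (i, j) ∈ [(2, 1), (3, 1), (4, 1), (4, 2)]) :
    WellFounded fun s t => CubicStep i j t s := by
  refine Subrelation.wf (fun {s t} hst => ?_) (measure (weight 2 1)).wf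
  refine CubicStep.weight_lt (fun x y z w => ?_) hst
  have hx := weight_pos two_pos 1 x
  have hy := weight_pos two_pos 1 y
  simp only [List.mem_cons, Prod.mk.injEq, List.not_mem_nil, or_false] at h
  rcases h with ⟨rfl, rfl⟩ | ⟨rfl, rfl⟩ | ⟨rfl, rfl⟩ | ⟨rfl, rfl⟩ <;>
    simp only [cubicInst, weight] <;> omega

lemma Relation.Join.head_left {α : Type*} {r : α → α → Prop} {a a' b : α} (h : r a a')
    (h' : Join (ReflTransGen r) a' b) : Join (ReflTransGen r) a b := by
  obtain ⟨c, hac, hbc⟩ := h'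
  exact ⟨c, hac.head h, hbc⟩

lemma Relation.Join.head_right {α : Type*} {r : α → α → Prop} {a b b' : α} (h : r b b')
    (h' : Join (ReflTransGen r) a b') : Join (ReflTransGen r) a b := by
  obtain ⟨c, hac, hbc⟩ := h'
  exact ⟨c, hac, hbc.head h⟩

set_option maxHeartbeats 4000000 in
lemma CubicStep.join_of_root {i j : ℕ}
    (hij : (i, j) ∈ [(2, 1), (3, 1), (4, 1), (4, 2)]) (x y z w c : BTree)
    (h : CubicStep i j (cubicInst i x y z w) c) :
    Join (ReflTransGen (CubicStep i j)) (cubicInst j x y z w) c := by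
  have rule (x y z w) : CubicStep i j (cubicInst i x y z w) (cubicInst j x y z w) :=
    .rule x y z w rfl rfl
  simp only [List.mem_cons, Prod.mk.injEq, List.not_mem_nil, or_false] at hij
  rcases hij with ⟨rfl, rfl⟩ | ⟨rfl, rfl⟩ | ⟨rfl, rfl⟩ | ⟨rfl, rfl⟩ <;>
    simp only [cubicInst, CubicStep.node_iff, node.injEq] at h <;>
    simp only [cubicInst] at rule ⊢
  · rcases h with ⟨_, _, _, _, ⟨rfl, ⟨rfl, rfl⟩, rfl⟩, rfl⟩ | ⟨_, h, rfl⟩ |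
      ⟨_, ⟨_, _, _, _, ⟨rfl, rfl⟩, rfl⟩ | ⟨_, ⟨_, _, _, _, ⟨rfl, rfl⟩, rfl⟩ | ⟨_, h, rfl⟩ |
        ⟨_, h, rfl⟩, rfl⟩ | ⟨_, h, rfl⟩, rfl⟩
    all_goals repeat first
      | exact ⟨_, .refl, .refl⟩
      | apply Join.head_left; focus solve_by_elim (maxDepth := 5) [CubicStep.left, CubicStep.right]
      | apply Join.head_right; focus solve_by_elim (maxDepth := 5) [CubicStep.left, CubicStep.right]
  · rcases h with ⟨_, _, _, _, ⟨⟨rfl, rfl⟩, rfl, rfl⟩, rfl⟩ |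
      ⟨_, ⟨_, _, _, _, ⟨rfl, rfl⟩, rfl⟩ | ⟨_, h, rfl⟩ | ⟨_, h, rfl⟩, rfl⟩ |
      ⟨_, ⟨_, _, _, _, ⟨rfl, rfl⟩, rfl⟩ | ⟨_, h, rfl⟩ | ⟨_, h, rfl⟩, rfl⟩
    all_goals repeat first
      | exact ⟨_, .refl, .refl⟩
      | apply Join.head_left; focus solve_by_elim (maxDepth := 5) [CubicStep.left, CubicStep.right]
      | apply Join.head_right; focus solve_by_elim (maxDepth := 5) [CubicStep.left, CubicStep.right]
  all_goals
    rcases h with ⟨_, _, _, _, ⟨⟨rfl, rfl, rfl⟩, rfl⟩, rfl⟩ |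
      ⟨_, ⟨_, _, _, _, ⟨rfl, rfl⟩, rfl⟩ | ⟨_, h, rfl⟩ | ⟨_, ⟨_, _, _, _, ⟨rfl, rfl⟩, rfl⟩ |
        ⟨_, h, rfl⟩ | ⟨_, h, rfl⟩, rfl⟩, rfl⟩ | ⟨_, h, rfl⟩
    all_goals repeat first
      | exact ⟨_, .refl, .refl⟩
      | apply Join.head_left; focus solve_by_elim (maxDepth := 5) [CubicStep.left, CubicStep.right]
      | apply Join.head_right; focus solve_by_elim (maxDepth := 5) [CubicStep.left, CubicStep.right]

lemma CubicStep.confluent {i j : ℕ} (hij : (i, j) ∈ [(2, 1), (3, 1), (4, 1), (4, 2)])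
    (a b c : BTree) (hab : ReflTransGen (CubicStep i j) a b)
    (hac : ReflTransGen (CubicStep i j) a c) : Join (ReflTransGen (CubicStep i j)) b c :=
  join_of_locally_confluent (CubicStep.wellFounded hij)
    (CubicStep.locally_confluent (CubicStep.join_of_root hij)) a b c hab hac

lemma terminating_and_confluent_of_cubicStep {i j : ℕ} (hi : i ∈ Finset.Icc 1 5)
    (hj : j ∈ Finset.Icc 1 5) (hwf : WellFounded fun s t => CubicStep i j t s)
    (hconf : ∀ a b c, ReflTransGen (CubicStep i j) a b → ReflTransGen (CubicStep i j) a c →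
      Join (ReflTransGen (CubicStep i j)) b c) :
    Terminating (fun s s' => s = cubic i ∧ s' = cubic j) ∧
      Confluent (fun s s' => s = cubic i ∧ s' = cubic j) := by
  have hstep : Step (fun s s' => s = cubic i ∧ s' = cubic j) = CubicStep i j := by
    ext t t'
    exact step_iff_cubicStep hi hj t t'
  unfold Terminating Confluent
  rw [hstep]
  refine ⟨?_, hconf⟩
  rintro ⟨f, hf⟩
  exact (wellFounded_iff_isEmpty_descending_chain.1 hwf).false ⟨f, hf⟩

/-- Mirroring turns the rule `cubic i → cubic j` into `cubic (6 - i) → cubic (6 - j)`. -/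
lemma terminating_and_confluent_of_mirror {i j : ℕ} (hi : i ∈ Finset.Icc 1 5)
    (hj : j ∈ Finset.Icc 1 5) (hij : (6 - i, 6 - j) ∈ [(2, 1), (3, 1), (4, 1), (4, 2)]) :
    Terminating (fun s s' => s = cubic i ∧ s' = cubic j) ∧
      Confluent (fun s s' => s = cubic i ∧ s' = cubic j) := by
  have hmirror {k : ℕ} (hk : k ∈ Finset.Icc 1 5) : 6 - k ∈ Finset.Icc 1 5 ∧ 6 - (6 - k) = k := by
    simp only [Finset.mem_Icc] at hk ⊢
    omega
  have hfwd : ∀ s t, CubicStep i j s t → CubicStep (6 - i) (6 - j) s.mirror t.mirror :=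
    fun _ _ => CubicStep.mirror hi hj
  have hback : ∀ s t, CubicStep (6 - i) (6 - j) s t → CubicStep i j s.mirror t.mirror := by
    intro s t hst
    simpa only [hmirror hi, hmirror hj] using CubicStep.mirror (hmirror hi).1 (hmirror hj).1 hst
  refine terminating_and_confluent_of_cubicStep hi hj ?_ ?_
  · exact Subrelation.wf (fun {s t} hst => hfwd t s hst)
      (InvImage.wf BTree.mirror (CubicStep.wellFounded hij))
  · intro a b c hab hac
    obtain ⟨d, hbd, hcd⟩ := CubicStep.confluent hij _ _ _ (hab.lift _ hfwd) (hac.lift _ hfwd)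
    refine ⟨d.mirror, ?_, ?_⟩
    · simpa only [Function.onFun, mirror_mirror] using hbd.lift BTree.mirror hback
    · simpa only [Function.onFun, mirror_mirror] using hcd.lift BTree.mirror hback

/-- Each of the eight one-rule rewrite systems `𝔞₂ → 𝔞₁`, `𝔞₄ → 𝔞₅`, `𝔞₃ → 𝔞₁`,
`𝔞₃ → 𝔞₅`, `𝔞₄ → 𝔞₁`, `𝔞₂ → 𝔞₅`, `𝔞₂ → 𝔞₄`, `𝔞₄ → 𝔞₂` induces a terminating and
confluent rewrite relation: they are convergent presentations of the
corresponding quotient operads. -/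
theorem stmt15 (i j : ℕ)
    (h : (i, j) ∈ [(2, 1), (4, 5), (3, 1), (3, 5), (4, 1), (2, 5), (2, 4), (4, 2)]) :
    Terminating (fun s s' => s = cubic i ∧ s' = cubic j) ∧
      Confluent (fun s s' => s = cubic i ∧ s' = cubic j) := by
  have direct {i j : ℕ} (hi : i ∈ Finset.Icc 1 5) (hj : j ∈ Finset.Icc 1 5)
      (hij : (i, j) ∈ [(2, 1), (3, 1), (4, 1), (4, 2)]) :=
    terminating_and_confluent_of_cubicStep hi hj (CubicStep.wellFounded hij)
      (CubicStep.confluent hij)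
  simp only [List.mem_cons, Prod.mk.injEq, List.not_mem_nil, or_false] at h
  rcases h with ⟨rfl, rfl⟩ | ⟨rfl, rfl⟩ | ⟨rfl, rfl⟩ | ⟨rfl, rfl⟩ | ⟨rfl, rfl⟩ | ⟨rfl, rfl⟩ |
    ⟨rfl, rfl⟩ | ⟨rfl, rfl⟩
  · exact direct (by simp) (by simp) (by simp)
  · exact terminating_and_confluent_of_mirror (by simp) (by simp) (by simp)
  · exact direct (by simp) (by simp) (by simp)
  · exact terminating_and_confluent_of_mirror (by simp) (by simp) (by simp)
  · exact direct (by simp) (by simp) (by simp)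
  · exact terminating_and_confluent_of_mirror (by simp) (by simp) (by simp)
  · exact terminating_and_confluent_of_mirror (by simp) (by simp) (by simp)
  · exact direct (by simp) (by simp) (by simp)
end
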